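/- arXiv:2110.04141 — 2 statements merged into one kernel-verified Lean document; each statement's English description precedes it below -/
import Mathlib

section
/- Let Γ be a finite simple graph, let G = G_Γ, and let P₁ and P₂ be two distinct maximal join parabolic subgroups of G, with centers Z₁ and Z₂ respectively. Then Z₁ ∩ Z₂ = {1}. -/
open MeasureTheory
open scoped ENNReal Pointwise symmDiff

namespace OEPaper

/- ## Right-angled Artin groups and graph combinatorics -/

/-- The commutation relations defining the right-angled Artin group of a graph. -/
def raagRels {V : Type} (Γ : SimpleGraph V) : Set (FreeGroup V) :=
  {r | ∃ u v : V, Γ.Adj u v ∧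
    r = FreeGroup.of u * FreeGroup.of v * (FreeGroup.of u)⁻¹ * (FreeGroup.of v)⁻¹}

/-- The right-angled Artin group of a simple graph `Γ`. -/
abbrev RAAG {V : Type} (Γ : SimpleGraph V) : Type := PresentedGroup (raagRels Γ)

/-- The standard generator of `RAAG Γ` associated to a vertex. -/
def gen {V : Type} (Γ : SimpleGraph V) (v : V) : RAAG Γ := PresentedGroup.of v

/-- The standard subgroup associated to (the full subgraph spanned by) a set of vertices. -/
def standardSub {V : Type} (Γ : SimpleGraph V) (S : Set V) : Subgroup (RAAG Γ) :=
  Subgroup.closure (gen Γ '' S)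

/-- Conjugate of a subgroup. -/
def conjSub {G : Type} [Group G] (g : G) (P : Subgroup G) : Subgroup G :=
  Subgroup.map (MulAut.conj g).toMonoidHom P

/-- Parabolic subgroups: conjugates of standard subgroups. -/
def IsParabolic {V : Type} (Γ : SimpleGraph V) (P : Subgroup (RAAG Γ)) : Prop :=
  ∃ (g : RAAG Γ) (S : Set V), P = conjSub g (standardSub Γ S)

/-- The "orthogonal" of a set of vertices: vertices outside `S` adjacent to every vertex of `S`. -/
def perp {V : Type} (Γ : SimpleGraph V) (S : Set V) : Set V :=
  {v : V | v ∉ S ∧ ∀ u ∈ S, Γ.Adj v u}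

/-- `S` spans a join subgraph of `Γ`. -/
def IsJoin {V : Type} (Γ : SimpleGraph V) (S : Set V) : Prop :=
  ∃ S₁ S₂ : Set V, S₁.Nonempty ∧ S₂.Nonempty ∧ S₁ ∪ S₂ = S ∧ ∀ u ∈ S₁, ∀ v ∈ S₂, Γ.Adj u v

/-- `S` spans a maximal join subgraph of `Γ`. -/
def IsMaxJoin {V : Type} (Γ : SimpleGraph V) (S : Set V) : Prop :=
  IsJoin Γ S ∧ ∀ T : Set V, IsJoin Γ T → S ⊆ T → S = T

/-- Join parabolic subgroups. -/
def IsJoinParabolic {V : Type} (Γ : SimpleGraph V) (P : Subgroup (RAAG Γ)) : Prop :=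
  ∃ (g : RAAG Γ) (S : Set V), IsJoin Γ S ∧ P = conjSub g (standardSub Γ S)

/-- Maximal join parabolic subgroups. -/
def IsMaxJoinParabolic {V : Type} (Γ : SimpleGraph V) (P : Subgroup (RAAG Γ)) : Prop :=
  ∃ (g : RAAG Γ) (S : Set V), IsMaxJoin Γ S ∧ P = conjSub g (standardSub Γ S)

/-- The center of a subgroup `P`, as a subset of the ambient group. -/
def subCenter {G : Type} [Group G] (P : Subgroup G) : Set G :=
  {x : G | x ∈ P ∧ ∀ y ∈ P, x * y = y * x}

/-- The commutation graph of a subset `S` of a group. -/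
def chainCommGraph {G : Type} [Group G] (S : Set G) : SimpleGraph S :=
  SimpleGraph.fromRel fun a b => Commute (a : G) (b : G)

/-- A generating set is chain-commuting if its commutation graph is connected. -/
def IsChainCommuting {G : Type} [Group G] (S : Set G) : Prop :=
  (chainCommGraph S).Connected

/-- Amenability: existence of a finitely additive left-invariant probability
measure defined on all subsets. -/
def IsAmenable (G : Type) [Group G] : Prop :=
  ∃ m : Set G → ℝ, m Set.univ = 1 ∧ (∀ A : Set G, 0 ≤ m A) ∧
    (∀ A B : Set G, Disjoint A B → m (A ∪ B) = m A + m B) ∧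
    ∀ (g : G) (A : Set G), m ((g * ·) '' A) = m A

/-- ICC groups: every nontrivial element has an infinite conjugacy class. -/
def IsICC (G : Type) [Group G] : Prop :=
  ∀ g : G, g ≠ 1 → {h : G | ∃ c : G, c * g * c⁻¹ = h}.Infinite

/-- The root-conjugation property. -/
def RootConjugationProperty (H : Type) [Group H] : Prop :=
  ∀ (h₁ h₂ : H) (k : ℕ), 0 < k → Commute h₁ (h₂ ^ k) → Commute h₁ h₂

/- ## Measured dynamics -/

/-- Measure-preserving action by measurable automorphisms. -/
def PmpAction (G : Type) [Group G] (X : Type) [MeasurableSpace X] [MulAction G X]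
    (μ : Measure X) : Prop :=
  ∀ g : G, MeasurePreserving (fun x : X => g • x) μ μ

/-- Essentially free action. -/
def FreeAction (G : Type) [Group G] (X : Type) [MeasurableSpace X] [MulAction G X]
    (μ : Measure X) : Prop :=
  ∀ g : G, g ≠ 1 → μ {x : X | g • x = x} = 0

/-- Ergodic action of a group. -/
def ErgodicAction (G : Type) [Group G] (X : Type) [MeasurableSpace X] [MulAction G X]
    (μ : Measure X) : Prop :=
  ∀ A : Set X, MeasurableSet A → (∀ g : G, (fun x : X => g • x) ⁻¹' A = A) →
    μ A = 0 ∨ μ A = 1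

/-- Ergodicity of the action of a subgroup. -/
def ErgodicSubgroup (G : Type) [Group G] (A : Subgroup G) (X : Type) [MeasurableSpace X]
    [MulAction G X] (μ : Measure X) : Prop :=
  ∀ s : Set X, MeasurableSet s → (∀ a ∈ A, (fun x : X => a • x) ⁻¹' s = s) →
    μ s = 0 ∨ μ s = 1

/-- Irreducible action of a right-angled Artin group: for some identification of the group
with a `RAAG Δ`, every standard generator acts ergodically. -/
def IrreducibleAction (G : Type) [Group G] (X : Type) [MeasurableSpace X] [MulAction G X]
    (μ : Measure X) : Prop :=
  ∃ (n : ℕ) (Δ : SimpleGraph (Fin n)) (e : RAAG Δ ≃* G),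
    ∀ v : Fin n, Ergodic (fun x : X => e (gen Δ v) • x) μ

/-- A measure space isomorphism (mod null sets): a measurable measure-preserving map
admitting an a.e. two-sided measurable inverse. -/
def MeasIso {A : Type} {B : Type} [MeasurableSpace A] [MeasurableSpace B]
    (μ : Measure A) (ν : Measure B) (F : A → B) : Prop :=
  Measurable F ∧ MeasurePreserving F μ ν ∧
    ∃ F' : B → A, Measurable F' ∧ (∀ᵐ a ∂μ, F' (F a) = a) ∧ ∀ᵐ b ∂ν, F (F' b) = b

/-- Conjugacy of two actions through a given group isomorphism. -/
def ConjugateVia (G : Type) [Group G] (X : Type) [MeasurableSpace X] [MulAction G X]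
    (H : Type) [Group H] (Y : Type) [MeasurableSpace Y] [MulAction H Y]
    (μ : Measure X) (ν : Measure Y) (α : G ≃* H) : Prop :=
  ∃ F : X → Y, MeasIso μ ν F ∧ ∀ g : G, ∀ᵐ x ∂μ, F (g • x) = α g • F x

/-- Conjugacy of two actions. -/
def ConjugateActions (G : Type) [Group G] (X : Type) [MeasurableSpace X] [MulAction G X]
    (H : Type) [Group H] (Y : Type) [MeasurableSpace Y] [MulAction H Y]
    (μ : Measure X) (ν : Measure Y) : Prop :=
  ∃ α : G ≃* H, ConjugateVia G X H Y μ ν α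

/-- Orbit equivalence of two actions. -/
def OrbitEquivalent (G : Type) [Group G] (X : Type) [MeasurableSpace X] [MulAction G X]
    (H : Type) [Group H] (Y : Type) [MeasurableSpace Y] [MulAction H Y]
    (μ : Measure X) (ν : Measure Y) : Prop :=
  ∃ F : X → Y, MeasIso μ ν F ∧
    ∀ᵐ x ∂μ, F '' MulAction.orbit G x = MulAction.orbit H (F x)

/-- Measurable cocycle for an action, with values in a (discrete) group `H`. -/
def IsCocycle (G : Type) [Group G] (X : Type) [MeasurableSpace X] [MulAction G X]
    (H : Type) [Group H] (μ : Measure X) (c : G → X → H) : Prop :=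
  (∀ (g : G) (h : H), MeasurableSet {x : X | c g x = h}) ∧
    ∀ g g' : G, ∀ᵐ x ∂μ, c (g * g') x = c g (g' • x) * c g' x

/-- Cohomology of cocycles. -/
def Cohomologous (G : Type) [Group G] (X : Type) [MeasurableSpace X] [MulAction G X]
    (H : Type) [Group H] (μ : Measure X) (c c' : G → X → H) : Prop :=
  ∃ φ : X → H, (∀ h : H, MeasurableSet {x : X | φ x = h}) ∧
    ∀ g : G, ∀ᵐ x ∂μ, c' g x = φ (g • x) * c g x * (φ x)⁻¹

/-- A stable orbit equivalence between two actions: a measure-scaling Borel isomorphism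
between positive measure subsets, matching orbits. -/
structure StableOE (G : Type) [Group G] (X : Type) [MeasurableSpace X] [MulAction G X]
    (H : Type) [Group H] (Y : Type) [MeasurableSpace Y] [MulAction H Y]
    (μ : Measure X) (ν : Measure Y) where
  U : Set X
  V : Set Y
  measU : MeasurableSet U
  measV : MeasurableSet V
  posU : 0 < μ U
  posV : 0 < ν V
  toFun : X → Y
  invFun : Y → X
  meas_toFun : Measurable toFun
  meas_invFun : Measurable invFun
  maps : Set.MapsTo toFun U V
  maps_inv : Set.MapsTo invFun V U
  left_inv : ∀ x ∈ U, invFun (toFun x) = x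
  right_inv : ∀ y ∈ V, toFun (invFun y) = y
  pushforward : ∀ B : Set Y, B ⊆ V → MeasurableSet B →
    (μ U)⁻¹ * μ (U ∩ toFun ⁻¹' B) = (ν V)⁻¹ * ν B
  orbit_eq : ∀ᵐ x ∂μ, x ∈ U →
    toFun '' (MulAction.orbit G x ∩ U) = MulAction.orbit H (toFun x) ∩ V

namespace StableOE

variable {G : Type} [Group G] {X : Type} [MeasurableSpace X] [MulAction G X]
  {H : Type} [Group H] {Y : Type} [MeasurableSpace Y] [MulAction H Y]
  {μ : Measure X} {ν : Measure Y}

/-- The compression constant of a stable orbit equivalence. -/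
noncomputable def kappa (f : StableOE G X H Y μ ν) : ℝ≥0∞ := ν f.V / μ f.U

/-- `c` is an SOE cocycle associated to the stable orbit equivalence `f`. -/
def IsSOECocycle (f : StableOE G X H Y μ ν) (c : G → X → H) : Prop :=
  IsCocycle G X H μ c ∧
    ∃ p : X → X, Measurable p ∧
      (∀ᵐ x ∂μ, p x ∈ f.U ∧ p x ∈ MulAction.orbit G x) ∧
      ∀ g : G, ∀ᵐ x ∂μ, f.toFun (p (g • x)) = c g x • f.toFun (p x)

end StableOE

/-- Mildly mixing action. -/
def MildlyMixing (H : Type) [Group H] (Y : Type) [MeasurableSpace Y] [MulAction H Y]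
    (ν : Measure Y) : Prop :=
  ∀ A : Set Y, MeasurableSet A → ν A ≠ 0 → ν A ≠ ν Set.univ →
    ∀ u : ℕ → H, Function.Injective u →
      0 < Filter.atTop.liminf fun n => ν (((u n • ·) '' A) ∆ A)

/- ## Virtual conjugacy -/

/-- `(Z, qact, ρ)` together with `π : X → Z` is a model for the quotient of the action
`G ↷ (X, μ)` by the normal subgroup `F`, with the induced `G ⧸ F`-action. -/
def IsQuotientModel {G : Type} [Group G] (F : Subgroup G) [F.Normal]
    {X : Type} [MeasurableSpace X] [MulAction G X] (μ : Measure X)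
    {Z : Type} [MeasurableSpace Z] (qact : G ⧸ F →* Equiv.Perm Z) (ρ : Measure Z)
    (π : X → Z) : Prop :=
  Measurable π ∧ Measure.map π μ = ρ ∧
    (∀ (g : G) (x : X), π (g • x) = qact (QuotientGroup.mk g) (π x)) ∧
    ∀ x y : X, π x = π y ↔ ∃ f ∈ F, f • x = y

/-- The action `act : Q →* Perm Z` on `(Z, ρ)` is (isomorphic to) the action induced from the
action `act' : K →* Perm X'` of the finite-index subgroup `K` on `(X', μ')`. -/
def InducedFrom {Q : Type} [Group Q] (K : Subgroup Q)
    {Z : Type} [MeasurableSpace Z] (act : Q →* Equiv.Perm Z) (ρ : Measure Z)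
    {X' : Type} [MeasurableSpace X'] (act' : ↥K →* Equiv.Perm X') (μ' : Measure X') : Prop :=
  letI : MeasurableSpace (Q ⧸ K) := ⊤
  ∃ σ : Q ⧸ K → Q, (∀ k : Q ⧸ K, (QuotientGroup.mk (σ k) : Q ⧸ K) = k) ∧
    ∃ Φ : X' × (Q ⧸ K) → Z,
      MeasIso (Measure.sum fun k : Q ⧸ K =>
        (K.index : ℝ≥0∞)⁻¹ • Measure.map (fun x' : X' => (x', k)) μ') ρ Φ ∧
      ∀ (g : Q) (k : Q ⧸ K) (h : ↥K), (h : Q) = (σ (g • k))⁻¹ * g * σ k →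
        ∀ᵐ x' ∂μ', Φ (act' h x', g • k) = act g (Φ (x', k))

/-- Data witnessing that two probability measure-preserving actions are virtually
conjugate. -/
structure VirtualConjugacyData
    (G₁ : Type) [Group G₁] (X₁ : Type) [MeasurableSpace X₁] [MulAction G₁ X₁] (μ₁ : Measure X₁)
    (G₂ : Type) [Group G₂] (X₂ : Type) [MeasurableSpace X₂] [MulAction G₂ X₂] (μ₂ : Measure X₂) :
    Type 1 where
  F₁ : Subgroup G₁
  F₂ : Subgroup G₂
  normal₁ : F₁.Normal
  normal₂ : F₂.Normal
  finite₁ : Finite F₁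
  finite₂ : Finite F₂
  K₁ : Subgroup (G₁ ⧸ F₁)
  K₂ : Subgroup (G₂ ⧸ F₂)
  finiteIndex₁ : K₁.FiniteIndex
  finiteIndex₂ : K₂.FiniteIndex
  X'₁ : Type
  X'₂ : Type
  mX'₁ : MeasurableSpace X'₁
  mX'₂ : MeasurableSpace X'₂
  μ'₁ : Measure X'₁
  μ'₂ : Measure X'₂
  prob₁ : IsProbabilityMeasure μ'₁
  prob₂ : IsProbabilityMeasure μ'₂
  act₁ : ↥K₁ →* Equiv.Perm X'₁
  act₂ : ↥K₂ →* Equiv.Perm X'₂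
  pmp₁ : ∀ k : ↥K₁, MeasurePreserving (act₁ k) μ'₁ μ'₁
  pmp₂ : ∀ k : ↥K₂, MeasurePreserving (act₂ k) μ'₂ μ'₂
  θ : ↥K₁ ≃* ↥K₂
  conjF : X'₁ → X'₂
  conjF_iso : MeasIso μ'₁ μ'₂ conjF
  conjF_equivariant : ∀ k : ↥K₁, ∀ᵐ x ∂μ'₁, conjF (act₁ k x) = act₂ (θ k) (conjF x)
  Z₁ : Type
  Z₂ : Type
  mZ₁ : MeasurableSpace Z₁
  mZ₂ : MeasurableSpace Z₂
  ρ₁ : Measure Z₁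
  ρ₂ : Measure Z₂
  qact₁ : G₁ ⧸ F₁ →* Equiv.Perm Z₁
  qact₂ : G₂ ⧸ F₂ →* Equiv.Perm Z₂
  qpmp₁ : ∀ g, MeasurePreserving (qact₁ g) ρ₁ ρ₁
  qpmp₂ : ∀ g, MeasurePreserving (qact₂ g) ρ₂ ρ₂
  π₁ : X₁ → Z₁
  π₂ : X₂ → Z₂
  quot₁ : IsQuotientModel F₁ μ₁ qact₁ ρ₁ π₁
  quot₂ : IsQuotientModel F₂ μ₂ qact₂ ρ₂ π₂
  ind₁ : InducedFrom K₁ qact₁ ρ₁ act₁ μ'₁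
  ind₂ : InducedFrom K₂ qact₂ ρ₂ act₂ μ'₂

/- ## Bernoulli actions -/

/-- The Bernoulli shift action of `G` on `G → A`. -/
instance bernoulliAction (G A : Type) [Group G] : MulAction G (G → A) where
  smul g x := fun h => x (g⁻¹ * h)
  one_smul x := funext fun h => by
    show x (1⁻¹ * h) = x h
    rw [inv_one, one_mul]
  mul_smul g g' x := funext fun h => by
    show x ((g * g')⁻¹ * h) = x (g'⁻¹ * (g⁻¹ * h))
    rw [mul_inv_rev, mul_assoc]

/-- `μ` is the product (Bernoulli) measure on `G → A` with base `μ₀`: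
it gives the product value to every cylinder set. -/
def IsBernoulliMeasure (G : Type) [Group G] {A : Type} [MeasurableSpace A]
    (μ₀ : Measure A) (μ : Measure (G → A)) : Prop :=
  ∀ (s : Finset G) (B : G → Set A), (∀ g : G, MeasurableSet (B g)) →
    μ {x : G → A | ∀ g ∈ s, x g ∈ B g} = ∏ g ∈ s, μ₀ (B g)


/-- `𝓕`-ergodicity: every subgroup in the collection `𝓕` acts ergodically. -/
def FErgodic (G : Type) [Group G] (𝓕 : Set (Subgroup G)) (X : Type) [MeasurableSpace X]
    [MulAction G X] (μ : Measure X) : Prop :=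
  ∀ A ∈ 𝓕, ErgodicSubgroup G A X μ

/-- Strong cocycle-rigidity of the pair `(G, 𝓕)`. -/
def StronglyCocycleRigid (G : Type) [Group G] (𝓕 : Set (Subgroup G)) : Prop :=
  ∀ (X : Type) [MeasurableSpace X] [StandardBorelSpace X] (μ : Measure X)
    (Y : Type) [MeasurableSpace Y] [StandardBorelSpace Y] (ν : Measure Y)
    [IsProbabilityMeasure μ] [IsProbabilityMeasure ν]
    [MulAction G X] [MulAction G Y],
    PmpAction G X μ → FreeAction G X μ → ErgodicAction G X μ → FErgodic G 𝓕 X μ →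
    PmpAction G Y ν → FreeAction G Y ν → ErgodicAction G Y ν → FErgodic G 𝓕 Y ν →
    ∀ f : StableOE G X G Y μ ν, ∀ c : G → X → G, f.IsSOECocycle c →
      ∃ α : G ≃* G, Cohomologous G X G μ c fun g _ => α g



theorem freeGroup_mk_replicate {α : Type*} (a : α) (b : Bool) (m : ℕ) :
    FreeGroup.mk (List.replicate m (a, b)) = FreeGroup.of a ^ (if b then (m : ℤ) else -m) := by
  induction m with
  | zero => simp [FreeGroup.one_eq_mk]
  | succ m ih =>
    have h : FreeGroup.mk [(a, b)] = FreeGroup.of a ^ (if b then (1 : ℤ) else -1) := by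
      cases b
      · simp [FreeGroup.of, FreeGroup.inv_mk, FreeGroup.invRev]
      · simp [FreeGroup.of]
    rw [List.replicate_succ, ← List.singleton_append, ← FreeGroup.mul_mk, ih, h, ← zpow_add]
    congr 1
    cases b <;> simp
    ring

/-- An element of a free group which is conjugated by a nontrivial power of a basis element `a`
to its image under a letter substitution fixing `a` is itself a power of `a`. -/
theorem mem_zpowers_of_twisted_commute {α : Type*} {a : α} {σ : α → α} (hσ : σ a = a)
    {n : ℤ} (hn : n ≠ 0) (f : FreeGroup α)
    (hf : FreeGroup.of a ^ n * FreeGroup.map σ f = f * FreeGroup.of a ^ n) :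
    f ∈ Subgroup.zpowers (FreeGroup.of a) := by
  classical
  induction hk : f.norm using Nat.strong_induction_on generalizing f with
  | _ k ih =>
  subst hk
  set t := FreeGroup.of a with ht
  have hmapt : ∀ i : ℤ, FreeGroup.map σ (t ^ i) = t ^ i := fun i => by
    rw [map_zpow, ht, FreeGroup.map.of, hσ]
  have key : ∀ (i j : ℤ) (g : FreeGroup α), f = t ^ i * g * t ^ j → g.norm < f.norm →
      f ∈ Subgroup.zpowers t := by
    intro i j g hg hlt
    have : g ∈ Subgroup.zpowers t := by
      refine ih _ hlt g ?_ rfl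
      rw [hg, map_mul, map_mul, hmapt, hmapt] at hf
      have e : t ^ i * (t ^ n * FreeGroup.map σ g) * t ^ j =
          t ^ i * (g * t ^ n) * t ^ j := by
        calc _ = t ^ n * (t ^ i * FreeGroup.map σ g * t ^ j) := by group
          _ = _ := hf
          _ = _ := by group
      exact mul_left_cancel (mul_right_cancel e)
    rw [hg]
    exact mul_mem (mul_mem (Subgroup.zpow_mem_zpowers _ _) this) (Subgroup.zpow_mem_zpowers _ _)
  have hletter : ∀ b : Bool, FreeGroup.mk [(a, b)] = t ^ (if b then (1 : ℤ) else -1) :=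
    fun b => by simpa using freeGroup_mk_replicate a b 1
  rcases hW : f.toWord with _ | ⟨c, W⟩
  · rw [FreeGroup.toWord_eq_nil_iff] at hW
    exact hW ▸ one_mem _
  have hfW : FreeGroup.mk (c :: W) = f := by rw [← hW, FreeGroup.mk_toWord]
  have hlen : f.norm = W.length + 1 := by rw [FreeGroup.norm, hW, List.length_cons]
  by_cases hc : c.1 = a
  · refine key (if c.2 then (1 : ℤ) else -1) 0 (FreeGroup.mk W) ?_ ?_
    · rw [← hletter, ← hc, FreeGroup.mul_mk, zpow_zero, mul_one, ← hfW]; rfl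
    · have := FreeGroup.norm_mk_le (L₁ := W); omega
  obtain ⟨W', d, hWd⟩ : ∃ W' d, c :: W = W' ++ [d] :=
    ⟨_, _, (List.dropLast_append_getLast (List.cons_ne_nil c W)).symm⟩
  by_cases hd : d.1 = a
  · refine key 0 (if d.2 then (1 : ℤ) else -1) (FreeGroup.mk W') ?_ ?_
    · rw [← hletter, ← hd, zpow_zero, one_mul, FreeGroup.mul_mk, ← hfW, hWd]
    · have := FreeGroup.norm_mk_le (L₁ := W')
      have h2 := congrArg List.length hWd
      simp at h2
      omega
  exfalso
  have hpow : ∀ (b : Bool) (m : ℕ), FreeGroup.IsReduced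
      (List.replicate m (a, !b) ++ (c :: W) ++ List.replicate m (a, b)) := by
    intro b m
    have hred : FreeGroup.IsReduced (c :: W) := hW ▸ FreeGroup.isReduced_toWord
    unfold FreeGroup.IsReduced at hred ⊢
    rw [List.append_assoc, List.isChain_append, List.isChain_append]
    refine ⟨List.isChain_replicate_of_rel _ (fun _ => rfl), ⟨hred,
      List.isChain_replicate_of_rel _ (fun _ => rfl), ?_⟩, ?_⟩
    · intro x hx y hy hxy
      rw [hWd] at hx
      simp at hx
      have := List.mem_of_mem_head? hy
      rw [List.mem_replicate] at this
      subst hx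
      exact absurd (hxy.trans (by rw [this.2])) hd
    · intro x hx y hy hxy
      simp at hy
      have := List.mem_of_mem_getLast? hx
      rw [List.mem_replicate] at this
      subst hy
      exact absurd (hxy.symm.trans (by rw [this.2])) hc
  have hσf : FreeGroup.map σ f = FreeGroup.mk (List.replicate n.natAbs (a, !decide (0 < n)) ++
      (c :: W) ++ List.replicate n.natAbs (a, decide (0 < n))) := by
    rw [← FreeGroup.mul_mk, ← FreeGroup.mul_mk, hfW, freeGroup_mk_replicate,
      freeGroup_mk_replicate, ← ht]
    have h1 : (if (decide (0 < n)) = true then (n.natAbs : ℤ) else -n.natAbs) = n := by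
      simp only [decide_eq_true_eq]; split_ifs <;> omega
    have h2 : (if (!decide (0 < n)) = true then (n.natAbs : ℤ) else -n.natAbs) = -n := by
      simp only [Bool.not_eq_true', decide_eq_false_iff_not]; split_ifs <;> omega
    rw [h1, h2, mul_assoc, ← hf]; group
  have hle : (FreeGroup.map σ f).norm ≤ f.norm := by
    rw [← hfW, FreeGroup.map.mk, hfW, hlen]
    exact FreeGroup.norm_mk_le.trans (by simp)
  rw [hσf, FreeGroup.norm, FreeGroup.toWord_mk,
    (hpow _ _).reduce_eq, hlen] at hle
  simp at hle
  omega

variable {V : Type} {Γ : SimpleGraph V}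

theorem gen_comm {u v : V} (h : Γ.Adj u v) : Commute (gen Γ u) (gen Γ v) := by
  have : PresentedGroup.mk (raagRels Γ) (FreeGroup.of u * FreeGroup.of v * (FreeGroup.of u)⁻¹ *
      (FreeGroup.of v)⁻¹) = 1 := PresentedGroup.one_of_mem ⟨u, v, h, rfl⟩
  simp only [map_mul, map_inv] at this
  exact mul_inv_eq_iff_eq_mul.mp (mul_inv_eq_one.mp this)

/-- A map on vertices preserving commutation along edges extends to the right-angled Artin
group. -/
def raagLift {H : Type*} [Group H] (f : V → H) (hf : ∀ u v, Γ.Adj u v → Commute (f u) (f v)) :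
    RAAG Γ →* H :=
  PresentedGroup.toGroup (f := f) (by
    rintro r ⟨u, v, huv, rfl⟩
    simp [(hf u v huv).eq])

@[simp]
theorem raagLift_gen {H : Type*} [Group H] (f : V → H)
    (hf : ∀ u v, Γ.Adj u v → Commute (f u) (f v)) (v : V) :
    raagLift f hf (gen Γ v) = f v :=
  PresentedGroup.toGroup.of _

theorem gen_mem_standardSub {S : Set V} {v : V} (hv : v ∈ S) : gen Γ v ∈ standardSub Γ S :=
  Subgroup.subset_closure ⟨v, hv, rfl⟩

theorem standardSub_mono {S T : Set V} (h : S ⊆ T) : standardSub Γ S ≤ standardSub Γ T :=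
  Subgroup.closure_mono (Set.image_mono h)

theorem raagHom_ext {H : Type*} [Group H] {f g : RAAG Γ →* H}
    (h : ∀ v, f (gen Γ v) = g (gen Γ v)) : f = g :=
  PresentedGroup.ext h

theorem eqOn_standardSub {H : Type*} [Group H] {f g : RAAG Γ →* H} {S : Set V}
    (h : ∀ v ∈ S, f (gen Γ v) = g (gen Γ v)) {x : RAAG Γ} (hx : x ∈ standardSub Γ S) :
    f x = g x :=
  MonoidHom.eqOn_closure (by rintro _ ⟨v, hv, rfl⟩; exact h v hv) hx

theorem map_mem_of_mem_standardSub {H : Type*} [Group H] {f : RAAG Γ →* H} {S : Set V}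
    {K : Subgroup H} (h : ∀ v ∈ S, f (gen Γ v) ∈ K) {x : RAAG Γ} (hx : x ∈ standardSub Γ S) :
    f x ∈ K :=
  (Subgroup.closure_le (K.comap f)).mpr (by rintro _ ⟨v, hv, rfl⟩; exact h v hv) hx

open Classical in
/-- The exponent sum of a vertex. -/
noncomputable def expSum (Γ : SimpleGraph V) (v : V) : RAAG Γ →* Multiplicative ℤ :=
  raagLift (fun w => if w = v then Multiplicative.ofAdd 1 else 1) fun _ _ _ => Commute.all _ _

open Classical in
/-- The retraction killing a single vertex. -/
noncomputable def killVertex (Γ : SimpleGraph V) (v : V) : RAAG Γ →* RAAG Γ :=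
  raagLift (fun w => if w = v then 1 else gen Γ w) fun u w h => by
    split_ifs
    exacts [Commute.refl _, Commute.one_left _, Commute.one_right _, gen_comm h]

theorem expSum_gen_self (v : V) : expSum Γ v (gen Γ v) = Multiplicative.ofAdd 1 := by
  simp [expSum]

theorem expSum_eq_one {v : V} {S : Set V} (hv : v ∉ S) {x : RAAG Γ}
    (hx : x ∈ standardSub Γ S) : expSum Γ v x = 1 :=
  eqOn_standardSub (g := 1) (fun w hw => by
    simp [expSum, show w ≠ v from fun h => hv (h ▸ hw)]) hx

theorem killVertex_eq_self {v : V} {S : Set V} (hv : v ∉ S) {x : RAAG Γ}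
    (hx : x ∈ standardSub Γ S) : killVertex Γ v x = x :=
  eqOn_standardSub (g := MonoidHom.id _) (fun w hw => by
    simp [killVertex, show w ≠ v from fun h => hv (h ▸ hw)]) hx

theorem killVertex_mem (v : V) {S : Set V} {x : RAAG Γ}
    (hx : x ∈ standardSub Γ S) : killVertex Γ v x ∈ standardSub Γ (S \ {v}) :=
  map_mem_of_mem_standardSub (fun w hw => by
    by_cases h : w = v
    · simp [killVertex, h, one_mem]
    · simpa [killVertex, h] using
        gen_mem_standardSub (Γ := Γ) (Set.mem_sdiff_singleton.mpr ⟨hw, h⟩)) hx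

/-- The closed star of a vertex. -/
abbrev closedStar (Γ : SimpleGraph V) (v : V) : Set V := insert v (Γ.neighborSet v)

theorem gen_commute_of_mem_link {v : V} {x : RAAG Γ}
    (hx : x ∈ standardSub Γ (Γ.neighborSet v)) : Commute (gen Γ v) x := by
  have : x ∈ Subgroup.centralizer {gen Γ v} :=
    map_mem_of_mem_standardSub (f := MonoidHom.id _) (fun w hw => by
      rw [Subgroup.mem_centralizer_singleton_iff]
      exact (gen_comm hw).symm) hx
  exact (Subgroup.mem_centralizer_singleton_iff.mp this).symm

theorem exists_eq_zpow_mul_of_mem_closedStar {v : V} {x : RAAG Γ}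
    (hx : x ∈ standardSub Γ (closedStar Γ v)) :
    ∃ y ∈ standardSub Γ (Γ.neighborSet v),
      x = gen Γ v ^ Multiplicative.toAdd (expSum Γ v x) * y := by
  have : ∃ n : ℤ, ∃ y ∈ standardSub Γ (Γ.neighborSet v), x = gen Γ v ^ n * y := by
    induction hx using Subgroup.closure_induction with
    | mem _ h =>
      obtain ⟨w, rfl | hw, rfl⟩ := h
      · exact ⟨1, 1, one_mem _, by simp⟩
      · exact ⟨0, _, gen_mem_standardSub hw, by simp⟩
    | one => exact ⟨0, 1, one_mem _, by simp⟩
    | mul _ _ _ _ h₁ h₂ =>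
      obtain ⟨n, y, hy, rfl⟩ := h₁
      obtain ⟨m, z, hz, rfl⟩ := h₂
      refine ⟨n + m, y * z, mul_mem hy hz, ?_⟩
      have := ((gen_commute_of_mem_link hy).zpow_left m).eq
      rw [mul_assoc, ← mul_assoc y, ← this, zpow_add]
      group
    | inv _ _ h =>
      obtain ⟨n, y, hy, rfl⟩ := h
      refine ⟨-n, y⁻¹, inv_mem hy, ?_⟩
      have := ((gen_commute_of_mem_link hy).zpow_left n).eq
      rw [this, mul_inv_rev, zpow_neg]
  obtain ⟨n, y, hy, rfl⟩ := this
  refine ⟨y, hy, ?_⟩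
  rw [map_mul, map_zpow, expSum_gen_self, expSum_eq_one (by simp) hy]
  simp

/-- The cosets of the standard subgroup on the link of a vertex. -/
abbrev LinkCosets (Γ : SimpleGraph V) (v : V) : Type :=
  RAAG Γ ⧸ standardSub Γ (Γ.neighborSet v)

/-- The permutation action on the free group over the cosets of a link. -/
def linkAction (Γ : SimpleGraph V) (v : V) : RAAG Γ →* MulAut (FreeGroup (LinkCosets Γ v)) where
  toFun g := FreeGroup.freeGroupCongr (MulAction.toPerm g)
  map_one' := by
    ext x
    induction x using FreeGroup.induction_on <;> simp_all
  map_mul' g h := by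
    ext x
    induction x using FreeGroup.induction_on <;> simp_all [mul_smul]

theorem linkAction_apply (v : V) (g : RAAG Γ) (f : FreeGroup (LinkCosets Γ v)) :
    linkAction Γ v g f = FreeGroup.map (g • ·) f := rfl

/-- The base coset of the link of `v`. -/
abbrev baseCoset (Γ : SimpleGraph V) (v : V) : LinkCosets Γ v := ((1 : RAAG Γ) : LinkCosets Γ v)

theorem smul_baseCoset_eq_iff {v : V} {g : RAAG Γ} :
    g • baseCoset Γ v = baseCoset Γ v ↔ g ∈ standardSub Γ (Γ.neighborSet v) := by
  rw [baseCoset, MulAction.Quotient.smul_coe, eq_comm, QuotientGroup.eq]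
  simp

open Classical in
/-- The embedding of a right-angled Artin group in the semidirect product of the free group on
the cosets of the link of `v`, sending `v` to the base coset. -/
noncomputable def toSemidirect (Γ : SimpleGraph V) (v : V) :
    RAAG Γ →* FreeGroup (LinkCosets Γ v) ⋊[linkAction Γ v] RAAG Γ :=
  raagLift (fun w => if w = v then SemidirectProduct.inl (FreeGroup.of (baseCoset Γ v))
    else SemidirectProduct.inr (gen Γ w)) (by
    have key : ∀ w, Γ.Adj v w → Commute
        (SemidirectProduct.inl (φ := linkAction Γ v) (FreeGroup.of (baseCoset Γ v)))
        (SemidirectProduct.inr (gen Γ w)) := fun w hw => by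
      have : gen Γ w • baseCoset Γ v = baseCoset Γ v :=
        smul_baseCoset_eq_iff.mpr (gen_mem_standardSub hw)
      ext <;> simp [linkAction_apply, this]
    intro u w h
    split_ifs with hu hw hw
    · exact Commute.refl _
    · subst hu; exact key w h
    · subst hw; exact (key u h.symm).symm
    · exact (gen_comm h).map _)

theorem toSemidirect_gen_self (v : V) :
    toSemidirect Γ v (gen Γ v) = SemidirectProduct.inl (FreeGroup.of (baseCoset Γ v)) := by
  simp [toSemidirect]

theorem toSemidirect_gen_of_ne {v w : V} (h : w ≠ v) :
    toSemidirect Γ v (gen Γ w) = SemidirectProduct.inr (gen Γ w) := by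
  simp [toSemidirect, h]

theorem toSemidirect_of_mem_link {v : V} {x : RAAG Γ}
    (hx : x ∈ standardSub Γ (Γ.neighborSet v)) :
    toSemidirect Γ v x = SemidirectProduct.inr x :=
  eqOn_standardSub (fun _ hw => toSemidirect_gen_of_ne (Γ.ne_of_adj hw).symm) hx

/-- The conjugates of `v`, indexed by the cosets of its link. -/
def cosetConj (Γ : SimpleGraph V) (v : V) : LinkCosets Γ v → RAAG Γ :=
  Quotient.lift (fun g => g * gen Γ v * g⁻¹) (by
    intro g h hgh
    have := (gen_commute_of_mem_link (QuotientGroup.leftRel_apply.mp hgh)).eq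
    calc g * gen Γ v * g⁻¹ = g * (gen Γ v * (g⁻¹ * h)) * h⁻¹ := by group
      _ = h * gen Γ v * h⁻¹ := by rw [this]; group)

theorem cosetConj_coe (v : V) (g : RAAG Γ) :
    cosetConj Γ v (g : LinkCosets Γ v) = g * gen Γ v * g⁻¹ := rfl

/-- A retraction of `toSemidirect`. -/
def ofSemidirect (Γ : SimpleGraph V) (v : V) :
    FreeGroup (LinkCosets Γ v) ⋊[linkAction Γ v] RAAG Γ →* RAAG Γ :=
  SemidirectProduct.lift (FreeGroup.lift (cosetConj Γ v)) (MonoidHom.id _) fun g => by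
    ext q
    induction q using QuotientGroup.induction_on with
    | H h => simp [linkAction_apply, cosetConj_coe, mul_assoc]

theorem ofSemidirect_toSemidirect (v : V) (x : RAAG Γ) :
    ofSemidirect Γ v (toSemidirect Γ v x) = x := by
  have : (ofSemidirect Γ v).comp (toSemidirect Γ v) = MonoidHom.id _ :=
    raagHom_ext fun w => by
      by_cases h : w = v
      · subst h
        simp [toSemidirect_gen_self, ofSemidirect, cosetConj_coe]
      · simp [toSemidirect_gen_of_ne h, ofSemidirect]
  exact DFunLike.congr_fun this x

open Classical in
/-- The exponent sum of the base coset. -/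
noncomputable def baseExp (Γ : SimpleGraph V) (v : V) :
    FreeGroup (LinkCosets Γ v) →* Multiplicative ℤ :=
  FreeGroup.lift fun q => if q = baseCoset Γ v then Multiplicative.ofAdd 1 else 1

theorem baseExp_linkAction {v : V} {x : RAAG Γ} (hx : x ∈ standardSub Γ (Γ.neighborSet v))
    (f : FreeGroup (LinkCosets Γ v)) : baseExp Γ v (linkAction Γ v x f) = baseExp Γ v f := by
  have : (baseExp Γ v).comp (linkAction Γ v x).toMonoidHom = baseExp Γ v := by
    ext q
    have : x • q = baseCoset Γ v ↔ q = baseCoset Γ v := by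
      conv_lhs => rw [← smul_baseCoset_eq_iff.mpr hx]
      exact smul_left_cancel_iff x
    simp only [linkAction_apply, baseExp, MonoidHom.comp_apply, MulEquiv.coe_toMonoidHom,
      FreeGroup.map.of, FreeGroup.lift_apply_of]
    split_ifs <;> tauto
  exact DFunLike.congr_fun this f

theorem toSemidirect_of_mem_closedStar {v : V} {x : RAAG Γ}
    (hx : x ∈ standardSub Γ (closedStar Γ v)) :
    ∃ y ∈ standardSub Γ (Γ.neighborSet v), toSemidirect Γ v x =
      ⟨FreeGroup.of (baseCoset Γ v) ^ Multiplicative.toAdd (expSum Γ v x), y⟩ := by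
  obtain ⟨y, hy, hxy⟩ := exists_eq_zpow_mul_of_mem_closedStar hx
  refine ⟨y, hy, ?_⟩
  conv_lhs => rw [hxy]
  rw [map_mul, map_zpow, toSemidirect_gen_self, toSemidirect_of_mem_link hy, ← map_zpow,
    SemidirectProduct.mk_eq_inl_mul_inr]

/-- An element conjugating two elements of the star subgroup of `v`, one of which has nonzero
exponent sum in `v`, lies in this star subgroup. -/
theorem mem_closedStar_of_conj {v : V} {x y h : RAAG Γ} (hx : x ∈ standardSub Γ (closedStar Γ v))
    (hy : y ∈ standardSub Γ (closedStar Γ v)) (hv : expSum Γ v x ≠ 1) (hxy : x * h = h * y) :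
    h ∈ standardSub Γ (closedStar Γ v) := by
  have hexp : expSum Γ v y = expSum Γ v x := by
    have := congrArg (expSum Γ v) hxy
    rw [map_mul, map_mul, mul_comm] at this
    exact (mul_left_cancel this).symm
  obtain ⟨x', hx', hxe⟩ := toSemidirect_of_mem_closedStar hx
  obtain ⟨y', hy', hye⟩ := toSemidirect_of_mem_closedStar hy
  rw [hexp] at hye
  have hn : Multiplicative.toAdd (expSum Γ v x) ≠ 0 := by simpa using hv
  set n := Multiplicative.toAdd (expSum Γ v x)
  have heq := congrArg (toSemidirect Γ v) hxy
  rw [map_mul, map_mul, hxe, hye] at heq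
  have hleft := congrArg SemidirectProduct.left heq
  simp only [SemidirectProduct.mul_left, map_zpow] at hleft
  have hfix : (toSemidirect Γ v h).right • baseCoset Γ v = baseCoset Γ v := by
    have e := congrArg (baseExp Γ v) hleft
    rw [map_mul, map_mul, baseExp_linkAction hx', mul_comm, map_zpow, map_zpow] at e
    have e' := mul_left_cancel e
    by_contra hne
    simp only [baseExp, linkAction_apply, FreeGroup.map.of, FreeGroup.lift_apply_of, hne,
      if_true, if_false, one_zpow] at e'
    exact hn (by simpa using congrArg Multiplicative.toAdd e')
  have hk := smul_baseCoset_eq_iff.mp hfix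
  rw [linkAction_apply, linkAction_apply, FreeGroup.map.of, hfix] at hleft
  obtain ⟨m, hm⟩ := mem_zpowers_of_twisted_commute (smul_baseCoset_eq_iff.mpr hx') hn _ hleft
  rw [← ofSemidirect_toSemidirect v h, ← SemidirectProduct.inl_left_mul_inr_right
    (toSemidirect Γ v h), ← hm, map_mul]
  refine mul_mem ?_ ?_
  · simpa [ofSemidirect, cosetConj_coe] using
      zpow_mem (gen_mem_standardSub (Set.mem_insert _ _)) m
  · simpa [ofSemidirect] using standardSub_mono (Set.subset_insert _ _) hk

theorem mem_closedStar_of_commute_gen {v : V} {x : RAAG Γ} (h : Commute x (gen Γ v)) :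
    x ∈ standardSub Γ (closedStar Γ v) :=
  have hv := gen_mem_standardSub (Γ := Γ) (Set.mem_insert v (Γ.neighborSet v))
  mem_closedStar_of_conj hv hv (by rw [expSum_gen_self]; decide) h.symm.eq

theorem subset_closedStar_of_expSum_ne_one {S : Set V} {x : RAAG Γ}
    (hx : x ∈ subCenter (standardSub Γ S)) {v : V} (hv : expSum Γ v x ≠ 1) :
    v ∈ S ∧ S ⊆ closedStar Γ v := by
  refine ⟨by_contra fun h => hv (expSum_eq_one h hx.1), fun w hw => ?_⟩
  by_contra hwv
  refine hv (expSum_eq_one (fun h => hwv ?_)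
    (mem_closedStar_of_commute_gen (hx.2 _ (gen_mem_standardSub hw))))
  rcases h with rfl | h
  · exact Set.mem_insert _ _
  · exact Set.mem_insert_of_mem _ h.symm

theorem exists_expSum_ne_one [Finite V] {S : Set V} {x : RAAG Γ}
    (hx : x ∈ subCenter (standardSub Γ S)) (hx1 : x ≠ 1) : ∃ v, expSum Γ v x ≠ 1 := by
  by_contra! hexp
  have key : ∀ F : Set V, F.Finite → F ⊆ S → x ∈ standardSub Γ (S \ F) := by
    intro F hF
    induction F, hF using Set.Finite.induction_on with
    | empty => intro; simpa using hx.1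
    | @insert v F _ _ ih =>
      intro hFS
      obtain ⟨y, hy, hxy⟩ := exists_eq_zpow_mul_of_mem_closedStar
        (mem_closedStar_of_commute_gen (hx.2 _ (gen_mem_standardSub (hFS (Set.mem_insert v F)))))
      rw [hexp v] at hxy
      have hy' : x ∈ standardSub Γ (Γ.neighborSet v) := by simpa [hxy] using hy
      have h := killVertex_mem v (ih ((Set.subset_insert v F).trans hFS))
      rw [killVertex_eq_self (by simp) hy'] at h
      rwa [← Set.union_singleton, ← Set.sdiff_sdiff]
  have := key S S.toFinite subset_rfl
  simp [standardSub] at this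
  exact hx1 this

theorem IsJoin.exists_adj {S : Set V} (hS : IsJoin Γ S) {v : V} (hv : v ∈ S) :
    ∃ w, Γ.Adj v w := by
  obtain ⟨S₁, S₂, ⟨a, ha⟩, ⟨b, hb⟩, rfl, h⟩ := hS
  rcases hv with hv | hv
  exacts [⟨b, h v hv b hb⟩, ⟨a, (h a ha v hv).symm⟩]

theorem IsMaxJoin.eq_closedStar {S : Set V} (hS : IsMaxJoin Γ S) {v : V} (hv : v ∈ S)
    (hSv : S ⊆ closedStar Γ v) : S = closedStar Γ v :=
  hS.2 _ ⟨{v}, Γ.neighborSet v, Set.singleton_nonempty v, hS.1.exists_adj hv, rfl,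
    by rintro _ rfl w hw; exact hw⟩ hSv

theorem conjSub_eq_of_mem {G : Type} [Group G] {P : Subgroup G} {g h : G} (hgh : g⁻¹ * h ∈ P) :
    conjSub g P = conjSub h P := by
  have := Subgroup.conj_smul_eq_self_of_mem hgh
  rw [map_mul, map_inv, mul_smul, inv_smul_eq_iff] at this
  exact this.symm

theorem subCenter_conjSub {G : Type} [Group G] {P : Subgroup G} {g z : G}
    (hz : z ∈ subCenter (conjSub g P)) : g⁻¹ * z * g ∈ subCenter P := by
  obtain ⟨⟨x, hx, rfl⟩, h⟩ := hz
  have e : g⁻¹ * MulAut.conj g x * g = x := by simp [mul_assoc]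
  erw [e]
  refine ⟨hx, fun y hy => ?_⟩
  have := h _ ⟨y, hy, rfl⟩
  apply (MulAut.conj g).injective
  simpa using this

/-- Two distinct maximal join parabolic subgroups have trivially
intersecting centers. -/
theorem stmt12
    {V : Type} [Fintype V] (Γ : SimpleGraph V)
    (P₁ P₂ : Subgroup (RAAG Γ))
    (h₁ : IsMaxJoinParabolic Γ P₁) (h₂ : IsMaxJoinParabolic Γ P₂) (hne : P₁ ≠ P₂) :
    subCenter P₁ ∩ subCenter P₂ = {1} := by
  obtain ⟨g, S, hS, rfl⟩ := h₁
  obtain ⟨h, T, hT, rfl⟩ := h₂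
  ext z
  refine ⟨fun ⟨hz₁, hz₂⟩ => ?_, ?_⟩
  · by_contra hz
    have hx := subCenter_conjSub hz₁
    have hy := subCenter_conjSub hz₂
    have hx1 : g⁻¹ * z * g ≠ 1 := fun e =>
      hz ((conj_eq_one_iff (a := g⁻¹)).mp (by simpa using e))
    obtain ⟨v, hv⟩ := exists_expSum_ne_one hx hx1
    have hv' : expSum Γ v (h⁻¹ * z * h) ≠ 1 := by
      simpa [mul_comm, mul_assoc, mul_left_comm] using hv
    obtain ⟨hvS, hSv⟩ := subset_closedStar_of_expSum_ne_one hx hv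
    obtain ⟨hvT, hTv⟩ := subset_closedStar_of_expSum_ne_one hy hv'
    obtain rfl := hS.eq_closedStar hvS hSv
    obtain rfl := hT.eq_closedStar hvT hTv
    exact hne (conjSub_eq_of_mem (mem_closedStar_of_conj hx.1 hy.1 hv (by group)))
  · rintro rfl
    exact ⟨⟨one_mem _, by simp⟩, ⟨one_mem _, by simp⟩⟩

end OEPaper
end

section
/- Let Γ be a finite simple graph such that the right-angled Artin group G_Γ has trivial center (equivalently, no vertex of Γ is adjacent to every other vertex of Γ). Then G_Γ is ICC: every nontrivial element of G_Γ has an infinite conjugacy class. -/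
open MeasureTheory
open scoped ENNReal Pointwise symmDiff

namespace OEPaper

/-- The conjugation action of a group `G` on the free group over its underlying set. -/
def freeConj (G : Type) [Group G] : G →* MulAut (FreeGroup G) where
  toFun g := FreeGroup.freeGroupCongr (MulAut.conj g).toEquiv
  map_one' := by
    ext x
    simp
  map_mul' g h := by
    ext x
    have : ∀ x, FreeGroup.freeGroupCongr (MulAut.conj (g * h)).toEquiv x =
        FreeGroup.freeGroupCongr (MulAut.conj g).toEquiv
          (FreeGroup.freeGroupCongr (MulAut.conj h).toEquiv x) := by
      intro x
      induction x using FreeGroup.induction_on <;> simp_all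
    simpa using this x

@[simp]
lemma freeConj_of {G : Type} [Group G] (g x : G) :
    freeConj G g (FreeGroup.of x) = FreeGroup.of (g * x * g⁻¹) := by
  simp [freeConj]

/-- Evaluation of formal products of conjugates, as a homomorphism to `G`. -/
def evalFreeConj (G : Type) [Group G] : FreeGroup G ⋊[freeConj G] G →* G :=
  SemidirectProduct.lift (FreeGroup.lift id) (MonoidHom.id G) fun g => by
    ext x
    simp

/-- If the normal factor of a semidirect product has unique roots, an element commuting with a
positive power of `inl n` commutes with `inl n`. -/
lemma commute_inl_of_commute_inl_pow {N H : Type*} [Group N] [Group H] [IsMulTorsionFree N]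
    {φ : H →* MulAut N} {a : N ⋊[φ] H} {n : N} {k : ℕ} (hk : k ≠ 0)
    (h : Commute a (SemidirectProduct.inl n ^ k)) : Commute a (SemidirectProduct.inl n) := by
  obtain ⟨m, hm⟩ : ∃ m : N, a * SemidirectProduct.inl n * a⁻¹ = SemidirectProduct.inl m := by
    have : a * SemidirectProduct.inl n * a⁻¹ ∈
        (SemidirectProduct.rightHom : N ⋊[φ] H →* H).ker := by
      simp [MonoidHom.mem_ker]
    rw [← SemidirectProduct.range_inl_eq_ker_rightHom] at this
    obtain ⟨m, hm⟩ := this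
    exact ⟨m, hm.symm⟩
  have hpow : m ^ k = n ^ k := by
    apply SemidirectProduct.inl_injective (φ := φ)
    rw [map_pow, map_pow, ← hm, conj_pow, h.eq, mul_inv_cancel_right]
  rw [pow_left_injective hk hpow] at hm
  exact mul_inv_eq_iff_eq_mul.mp hm

/-- The images of the standard generators under `splitHom Γ v`. -/
noncomputable def splitGen {V : Type} (Γ : SimpleGraph V) (v u : V) :
    FreeGroup (RAAG Γ) ⋊[freeConj (RAAG Γ)] RAAG Γ :=
  open Classical in
  if u = v then SemidirectProduct.inl (FreeGroup.of (gen Γ v))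
  else SemidirectProduct.inr (gen Γ u)

lemma gen_commute {V : Type} {Γ : SimpleGraph V} {u v : V} (h : Γ.Adj u v) :
    Commute (gen Γ u) (gen Γ v) := by
  have hr : PresentedGroup.mk (raagRels Γ) (FreeGroup.of u * FreeGroup.of v *
      (FreeGroup.of u)⁻¹ * (FreeGroup.of v)⁻¹) = 1 :=
    PresentedGroup.one_of_mem ⟨u, v, h, rfl⟩
  simp only [map_mul, map_inv] at hr
  exact mul_inv_eq_iff_eq_mul.mp (mul_inv_eq_one.mp hr)

lemma commute_inl_inr_of_commute {G : Type} [Group G] {x y : G} (h : Commute x y) :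
    Commute (SemidirectProduct.inl (φ := freeConj G) (FreeGroup.of x))
      (SemidirectProduct.inr y) := by
  refine (mul_inv_eq_iff_eq_mul.mp ?_ : Commute _ _).symm
  rw [← map_inv, ← SemidirectProduct.inl_aut, freeConj_of, h.symm.eq, mul_inv_cancel_right]

lemma splitGen_commute {V : Type} {Γ : SimpleGraph V} (v : V) {u w : V} (h : Γ.Adj u w) :
    Commute (splitGen Γ v u) (splitGen Γ v w) := by
  unfold splitGen
  split_ifs with hu hw hw
  · exact Commute.refl _
  · exact commute_inl_inr_of_commute (gen_commute (hu ▸ h))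
  · exact (commute_inl_inr_of_commute (gen_commute (hw ▸ h.symm))).symm
  · exact (gen_commute h).map _

/-- The embedding of a right-angled Artin group in a semidirect product that sends the
generator `v` to a free generator of the normal factor, and every other generator to the
complement. -/
noncomputable def splitHom {V : Type} (Γ : SimpleGraph V) (v : V) :
    RAAG Γ →* FreeGroup (RAAG Γ) ⋊[freeConj (RAAG Γ)] RAAG Γ :=
  PresentedGroup.toGroup (f := splitGen Γ v) <| by
    rintro r ⟨u, w, h, rfl⟩
    simp [(splitGen_commute v h).eq]

lemma splitHom_gen {V : Type} (Γ : SimpleGraph V) (v u : V) :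
    splitHom Γ v (gen Γ u) = splitGen Γ v u :=
  PresentedGroup.toGroup.of _

lemma splitHom_injective {V : Type} (Γ : SimpleGraph V) (v : V) :
    Function.Injective (splitHom Γ v) := by
  have h : (evalFreeConj (RAAG Γ)).comp (splitHom Γ v) = MonoidHom.id _ := by
    refine PresentedGroup.ext fun u => ?_
    change evalFreeConj (RAAG Γ) (splitHom Γ v (gen Γ u)) = gen Γ u
    rw [splitHom_gen, splitGen]
    split_ifs with hu
    · simp [evalFreeConj, hu]
    · simp [evalFreeConj]
  exact Function.LeftInverse.injective (g := evalFreeConj (RAAG Γ)) (DFunLike.congr_fun h)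

/-- An element commuting with a positive power of a standard generator commutes with it. -/
lemma commute_gen_of_commute_gen_pow {V : Type} {Γ : SimpleGraph V} {g : RAAG Γ} {v : V} {k : ℕ}
    (hk : k ≠ 0) (h : Commute g (gen Γ v ^ k)) : Commute g (gen Γ v) := by
  have hv : splitHom Γ v (gen Γ v) = SemidirectProduct.inl (FreeGroup.of (gen Γ v)) := by
    rw [splitHom_gen, splitGen, if_pos rfl]
  have h' := h.map (splitHom Γ v)
  rw [map_pow, hv] at h'
  have h'' := commute_inl_of_commute_inl_pow hk h'
  rw [← hv] at h''
  exact h''.of_map (splitHom_injective Γ v)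

/-- If `g` has finitely many conjugates, it commutes with a positive power of every element. -/
lemma exists_commute_pow_of_finite_conjugates {G : Type*} [Group G] {g : G}
    (hg : {h : G | ∃ c : G, c * g * c⁻¹ = h}.Finite) (x : G) :
    ∃ k : ℕ, k ≠ 0 ∧ Commute g (x ^ k) := by
  obtain ⟨i, j, hij, h⟩ : ∃ i j : ℕ, i < j ∧
      x ^ i * g * (x ^ i)⁻¹ = x ^ j * g * (x ^ j)⁻¹ := by
    obtain ⟨i, -, j, -, hne, h⟩ := Set.infinite_univ.exists_ne_map_eq_of_mapsTo
      (f := fun n : ℕ => x ^ n * g * (x ^ n)⁻¹)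
      (t := {h : G | ∃ c : G, c * g * c⁻¹ = h}) (fun n _ => ⟨x ^ n, rfl⟩) hg
    rcases hne.lt_or_gt with hlt | hlt
    · exact ⟨i, j, hlt, h⟩
    · exact ⟨j, i, hlt, h.symm⟩
  refine ⟨j - i, by omega, ?_⟩
  have hj : x ^ j = x ^ i * x ^ (j - i) := by rw [← pow_add]; congr 1; omega
  rw [hj] at h
  have h2 : g = x ^ (j - i) * g * (x ^ (j - i))⁻¹ := by
    apply mul_right_cancel (b := (x ^ i)⁻¹)
    simpa [mul_assoc] using h
  exact eq_mul_inv_iff_mul_eq.mp h2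

/-- Every centerless right-angled Artin group is ICC. -/
theorem stmt14
    {V : Type} [Fintype V] (Γ : SimpleGraph V)
    (hcenter : Subgroup.center (RAAG Γ) = ⊥) :
    IsICC (RAAG Γ) := by
  intro g hg
  by_contra hinf
  have hfin := Set.not_infinite.mp hinf
  have hgen : ∀ v : V, gen Γ v ∈ Subgroup.centralizer {g} := fun v => by
    obtain ⟨k, hk, h⟩ := exists_commute_pow_of_finite_conjugates hfin (gen Γ v)
    exact Subgroup.mem_centralizer_singleton_iff.mpr (commute_gen_of_commute_gen_pow hk h).symm.eq
  have htop : Subgroup.centralizer {g} = ⊤ := by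
    rw [eq_top_iff, ← PresentedGroup.closure_range_of, Subgroup.closure_le]
    rintro _ ⟨v, rfl⟩
    exact hgen v
  have hmem : g ∈ Subgroup.center (RAAG Γ) := Subgroup.mem_center_iff.mpr fun x =>
    Subgroup.mem_centralizer_singleton_iff.mp (htop ▸ Subgroup.mem_top x)
  rw [hcenter, Subgroup.mem_bot] at hmem
  exact hg hmem

end OEPaper
end
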